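/- For every real constant t > 1 there exists a finite set P of points in the plane in general position and points a, d ∈ P such that there is a directed path from a to d in the directed Yao graph Y4^{{0,1}}(P), and every directed path from a to d in Y4^{{0,1}}(P) has total Euclidean length greater than t · dist(a, d). Hence Y4^{{0,1}} is not a directed t-spanner for any constant t. -/

import Mathlib

noncomputable section

/-- A point in the plane, with Euclidean distance. -/
abbrev Pt : Type := EuclideanSpace ℝ (Fin 2)

/-- `quadrant i a p` : `p` lies in the (open) quadrant `Q_i` at `a`. -/
def quadrant : Fin 4 → Pt → Pt → Prop
  | 0, a, p => a 0 < p 0 ∧ a 1 < p 1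
  | 1, a, p => p 0 < a 0 ∧ a 1 < p 1
  | 2, a, p => p 0 < a 0 ∧ p 1 < a 1
  | 3, a, p => a 0 < p 0 ∧ p 1 < a 1

/-- General position: all pairwise distances between distinct pairs are distinct,
and no two distinct points share an x- or y-coordinate. -/
def GenPos (P : Finset Pt) : Prop :=
  (∀ a ∈ P, ∀ b ∈ P, ∀ c ∈ P, ∀ d ∈ P,
      a ≠ b → c ≠ d → ({a, b} : Set Pt) ≠ ({c, d} : Set Pt) → dist a b ≠ dist c d) ∧
  (∀ a ∈ P, ∀ b ∈ P, a ≠ b → a 0 ≠ b 0 ∧ a 1 ≠ b 1)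

/-- `YaoEdge l P a b` : `a → b` is a directed edge of the Yao graph `Y4^l(P)`,
i.e. for some quadrant index `i ∈ l`, `b` is a point of `P` in `Q_i(a)` at minimum
Euclidean distance from `a`. -/
def YaoEdge (l : List (Fin 4)) (P : Finset Pt) (a b : Pt) : Prop :=
  a ∈ P ∧ b ∈ P ∧ ∃ i ∈ l, quadrant i a b ∧
    ∀ c ∈ P, quadrant i a c → dist a b ≤ dist a c

/-- The undirected edge relation underlying the directed Yao graph. -/
def UYaoEdge (l : List (Fin 4)) (P : Finset Pt) (a b : Pt) : Prop :=
  YaoEdge l P a b ∨ YaoEdge l P b a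

theorem dist_sq_eq (p q : Pt) : dist p q ^ 2 = (p 0 - q 0) ^ 2 + (p 1 - q 1) ^ 2 := by
  rw [EuclideanSpace.dist_eq, Real.sq_sqrt (by positivity)]
  simp [Real.dist_eq, sq_abs]

theorem dist_le_dist_iff_coord (p q r s : Pt) :
    dist p q ≤ dist r s ↔
      (p 0 - q 0) ^ 2 + (p 1 - q 1) ^ 2 ≤ (r 0 - s 0) ^ 2 + (r 1 - s 1) ^ 2 := by
  rw [← dist_sq_eq, ← dist_sq_eq, sq_le_sq₀ dist_nonneg dist_nonneg]

theorem quadrant_zero (p q : Pt) : quadrant 0 p q ↔ p 0 < q 0 ∧ p 1 < q 1 := Iff.rfl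

theorem quadrant_one (p q : Pt) : quadrant 1 p q ↔ q 0 < p 0 ∧ p 1 < q 1 := Iff.rfl

/-- The start point. -/
def startPt : Pt := !₂[0, 0]

/-- The nearest neighbour of the start point in `Q0`, from which the goal is unreachable. -/
def decoyPt : Pt := !₂[90, 1]

/-- The far away point through which every path to the goal has to pass. -/
def farPt (L : ℝ) : Pt := !₂[-L, 50]

/-- The end point. -/
def goalPt : Pt := !₂[1, 100]

/-- The point above the goal which is the only out-neighbour of the decoy. -/
def topPt : Pt := !₂[89, 110]

theorem startPt_x : startPt 0 = 0 := rfl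
theorem startPt_y : startPt 1 = 0 := rfl
theorem decoyPt_x : decoyPt 0 = 90 := rfl
theorem decoyPt_y : decoyPt 1 = 1 := rfl
theorem farPt_x (L : ℝ) : farPt L 0 = -L := rfl
theorem farPt_y (L : ℝ) : farPt L 1 = 50 := rfl
theorem goalPt_x : goalPt 0 = 1 := rfl
theorem goalPt_y : goalPt 1 = 100 := rfl
theorem topPt_x : topPt 0 = 89 := rfl
theorem topPt_y : topPt 1 = 110 := rfl

attribute [local simp] startPt_x startPt_y decoyPt_x decoyPt_y farPt_x farPt_y goalPt_x goalPt_y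
  topPt_x topPt_y

open Classical in
/-- The five-point configuration with parameter `L`. -/
def detourSet (L : ℝ) : Finset Pt := {startPt, decoyPt, farPt L, goalPt, topPt}

theorem mem_detourSet {L : ℝ} {p : Pt} : p ∈ detourSet L ↔
    p = startPt ∨ p = decoyPt ∨ p = farPt L ∨ p = goalPt ∨ p = topPt := by
  simp [detourSet]

/-- The pairs of points of `detourSet L`, ordered by distance. -/
def detourPair (L : ℝ) : Fin 10 → Set Pt :=
  ![{goalPt, topPt}, {startPt, decoyPt}, {startPt, goalPt}, {decoyPt, topPt}, {decoyPt, goalPt},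
    {startPt, topPt}, {startPt, farPt L}, {farPt L, goalPt}, {farPt L, topPt}, {decoyPt, farPt L}]

/-- The squared distances of the pairs in `detourPair L`. -/
def detourDistSq (L : ℝ) : Fin 10 → ℝ :=
  ![7844, 8101, 10001, 11882, 17722, 20021, L ^ 2 + 2500, (L + 1) ^ 2 + 2500,
    (L + 89) ^ 2 + 3600, (L + 90) ^ 2 + 2401]

theorem detourDistSq_strictMono {L : ℝ} (hL : 1000 < L) : StrictMono (detourDistSq L) := by
  rw [Fin.strictMono_iff_lt_succ]
  intro i
  fin_cases i <;> simp [detourDistSq] <;> nlinarith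

theorem exists_detourPair {L : ℝ} {p q : Pt} (hp : p ∈ detourSet L) (hq : q ∈ detourSet L)
    (hpq : p ≠ q) : ∃ i, ({p, q} : Set Pt) = detourPair L i ∧ dist p q ^ 2 = detourDistSq L i := by
  wlog h : p 1 < q 1 generalizing p q
  · rw [Set.pair_comm, dist_comm]
    refine this hq hp hpq.symm (lt_of_le_of_ne (not_lt.1 h) ?_)
    rw [mem_detourSet] at hp hq
    rcases hp with rfl | rfl | rfl | rfl | rfl <;> rcases hq with rfl | rfl | rfl | rfl | rfl <;>
      first | exact absurd rfl hpq | norm_num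
  rw [mem_detourSet] at hp hq
  simp only [dist_sq_eq]
  rcases hp with rfl | rfl | rfl | rfl | rfl <;> rcases hq with rfl | rfl | rfl | rfl | rfl <;>
    first
    | exact absurd rfl hpq
    | (exfalso; norm_num at h; done)
    | skip
  · exact ⟨1, rfl, by simp [detourDistSq]; norm_num⟩
  · exact ⟨6, rfl, by simp [detourDistSq]; norm_num⟩
  · exact ⟨2, rfl, by simp [detourDistSq]; norm_num⟩
  · exact ⟨5, rfl, by simp [detourDistSq]; norm_num⟩
  · exact ⟨9, rfl, by simp [detourDistSq]; ring⟩
  · exact ⟨4, rfl, by simp [detourDistSq]; norm_num⟩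
  · exact ⟨3, rfl, by simp [detourDistSq]; norm_num⟩
  · exact ⟨7, rfl, by simp [detourDistSq]; ring⟩
  · exact ⟨8, rfl, by simp [detourDistSq]; ring⟩
  · exact ⟨0, rfl, by simp [detourDistSq]; norm_num⟩

theorem genPos_detourSet {L : ℝ} (hL : 1000 < L) : GenPos (detourSet L) := by
  refine ⟨fun a ha b hb c hc d hd hab hcd hne h => hne ?_, fun a ha b hb hab => ?_⟩
  · obtain ⟨i, hi, hi'⟩ := exists_detourPair ha hb hab
    obtain ⟨j, hj, hj'⟩ := exists_detourPair hc hd hcd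
    have hij : i = j := (detourDistSq_strictMono hL).injective (by rw [← hi', ← hj', h])
    rw [hi, hj, hij]
  · rw [mem_detourSet] at ha hb
    rcases ha with rfl | rfl | rfl | rfl | rfl <;> rcases hb with rfl | rfl | rfl | rfl | rfl <;>
      first
      | exact absurd rfl hab
      | (constructor <;> simp only [startPt_x, startPt_y, decoyPt_x, decoyPt_y, farPt_x, farPt_y,
          goalPt_x, goalPt_y, topPt_x, topPt_y] <;> intro h <;> linarith)

theorem yaoEdge_zero_one_iff {P : Finset Pt} {p q : Pt} : YaoEdge [0, 1] P p q ↔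
    p ∈ P ∧ q ∈ P ∧
      ((quadrant 0 p q ∧ ∀ r ∈ P, quadrant 0 p r → dist p q ≤ dist p r) ∨
        (quadrant 1 p q ∧ ∀ r ∈ P, quadrant 1 p r → dist p q ≤ dist p r)) := by
  simp [YaoEdge]

theorem YaoEdge.snd_lt {P : Finset Pt} {p q : Pt} (h : YaoEdge [0, 1] P p q) : p 1 < q 1 := by
  rw [yaoEdge_zero_one_iff] at h
  obtain ⟨-, -, ⟨h, -⟩ | ⟨h, -⟩⟩ := h
  exacts [h.2, h.2]

theorem forall_mem_detourSet {L : ℝ} {Q : Pt → Prop} : (∀ p ∈ detourSet L, Q p) ↔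
    Q startPt ∧ Q decoyPt ∧ Q (farPt L) ∧ Q goalPt ∧ Q topPt := by
  simp [mem_detourSet]

theorem yaoEdge_startPt_farPt {L : ℝ} (hL : 1000 < L) :
    YaoEdge [0, 1] (detourSet L) startPt (farPt L) := by
  refine yaoEdge_zero_one_iff.2 ⟨by simp [mem_detourSet], by simp [mem_detourSet], Or.inr ⟨?_, ?_⟩⟩
  · simp [quadrant_one]; linarith
  · rw [forall_mem_detourSet]
    norm_num [quadrant_one]

theorem yaoEdge_farPt_goalPt {L : ℝ} (hL : 1000 < L) :
    YaoEdge [0, 1] (detourSet L) (farPt L) goalPt := by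
  refine yaoEdge_zero_one_iff.2 ⟨by simp [mem_detourSet], by simp [mem_detourSet], Or.inl ⟨?_, ?_⟩⟩
  · norm_num [quadrant_zero]; linarith
  · rw [forall_mem_detourSet]
    norm_num [quadrant_zero, dist_le_dist_iff_coord]
    intro _
    nlinarith

theorem YaoEdge.eq_of_startPt {L : ℝ} {p : Pt} (h : YaoEdge [0, 1] (detourSet L) startPt p) :
    p = decoyPt ∨ p = farPt L := by
  obtain ⟨-, hp, h⟩ := yaoEdge_zero_one_iff.1 h
  simp only [forall_mem_detourSet, quadrant_zero, quadrant_one, dist_le_dist_iff_coord] at h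
  rcases mem_detourSet.1 hp with rfl | rfl | rfl | rfl | rfl
  · norm_num at h
  · exact Or.inl rfl
  · exact Or.inr rfl
  · norm_num at h
  · norm_num at h

theorem YaoEdge.eq_of_decoyPt {L : ℝ} (hL : 1000 < L) {p : Pt}
    (h : YaoEdge [0, 1] (detourSet L) decoyPt p) : p = topPt := by
  obtain ⟨-, hp, h⟩ := yaoEdge_zero_one_iff.1 h
  simp only [forall_mem_detourSet, quadrant_zero, quadrant_one, dist_le_dist_iff_coord] at h
  rcases mem_detourSet.1 hp with rfl | rfl | rfl | rfl | rfl
  · norm_num at h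
  · norm_num at h
  · norm_num at h
    rcases h with h | h
    · linarith
    · nlinarith [h.2.2]
  · norm_num at h
  · rfl

theorem not_yaoEdge_topPt {L : ℝ} {p : Pt} : ¬ YaoEdge [0, 1] (detourSet L) topPt p := by
  intro h
  have hlt := h.snd_lt
  rcases mem_detourSet.1 h.2.1 with rfl | rfl | rfl | rfl | rfl <;> norm_num at hlt

/-- For every `t > 1` there is a finite point set `P` in general position
and points `a, d ∈ P` such that some directed path in `Y4^{{0,1}}(P)` goes from `a` to
`d`, yet every directed path from `a` to `d` has length more than `t · dist a d`.
Hence `Y4^{{0,1}}` is not a directed `t`-spanner for any constant `t`. -/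
theorem yao01_not_directed_spanner :
    ∀ t : ℝ, 1 < t → ∃ (P : Finset Pt), GenPos P ∧ ∃ a ∈ P, ∃ d ∈ P,
      (∃ (k : ℕ) (p : ℕ → Pt), p 0 = a ∧ p k = d ∧
        ∀ j < k, YaoEdge [0, 1] P (p j) (p (j + 1))) ∧
      (∀ (k : ℕ) (p : ℕ → Pt), p 0 = a → p k = d →
        (∀ j < k, YaoEdge [0, 1] P (p j) (p (j + 1))) →
        t * dist a d < ∑ j ∈ Finset.range k, dist (p j) (p (j + 1))) := by
  intro t ht
  obtain ⟨L, hLt⟩ : ∃ L : ℝ, L = 101 * t + 1000 := ⟨_, rfl⟩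
  have hL : 1000 < L := by linarith
  have hgoal : dist startPt goalPt ≤ 101 := by
    have h := dist_sq_eq startPt goalPt
    norm_num at h
    nlinarith
  have hfar : L ≤ dist startPt (farPt L) := by
    have h := dist_sq_eq startPt (farPt L)
    norm_num at h
    exact le_of_sq_le_sq (by linarith) dist_nonneg
  have hsg : startPt ≠ goalPt := fun h => by simpa using congrArg (· 1) h
  have hdg : decoyPt ≠ goalPt := fun h => by simpa using congrArg (· 0) h
  have htg : topPt ≠ goalPt := fun h => by simpa using congrArg (· 0) h
  refine ⟨detourSet L, genPos_detourSet hL, startPt, by simp [mem_detourSet], goalPt,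
    by simp [mem_detourSet], ⟨2, ![startPt, farPt L, goalPt] ∘ Fin.ofNat 3, rfl, rfl, ?_⟩, ?_⟩
  · intro j hj
    interval_cases j
    exacts [yaoEdge_startPt_farPt hL, yaoEdge_farPt_goalPt hL]
  · intro k p h0 hk hp
    have hk0 : 0 < k := Nat.pos_of_ne_zero fun h => hsg (by rw [← h0, ← hk, h])
    have e0 := hp 0 hk0
    rw [h0] at e0
    rcases e0.eq_of_startPt with h1 | h1
    · have hk1 : 1 < k := lt_of_le_of_ne hk0 fun h => hdg (by rw [← h1, ← hk, ← h])
      have e1 := hp 1 hk1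
      rw [← zero_add 1, h1] at e1
      have h2 := e1.eq_of_decoyPt hL
      have hk2 : 2 < k := lt_of_le_of_ne hk1 fun h => htg (by rw [← h2, ← hk, ← h])
      have e2 := hp 2 hk2
      rw [show p 2 = topPt from h2] at e2
      exact absurd e2 not_yaoEdge_topPt
    · calc t * dist startPt goalPt ≤ t * 101 := by gcongr
        _ < L := by linarith
        _ ≤ dist (p 0) (p (0 + 1)) := by rwa [h0, h1]
        _ ≤ _ := Finset.single_le_sum (f := fun j => dist (p j) (p (j + 1)))
          (fun _ _ => dist_nonneg) (Finset.mem_range.2 hk0)
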